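/- Fix a coefficient α ≥ 2 and a number of agents n. On instances in which at least one agent prefers F_1 and at least one agent prefers F_2, Mechanism 2 is strategyproof in the private-preferences setting and always outputs a solution achieving the optimal minimum utility (i.e., it is 1-approximate under the minimum utility objective). -/

import Mathlib

open scoped BigOperators

noncomputable section

/-- A location profile of `n` agents on the line. -/
abbrev Loc (n : ℕ) := Fin n → ℝ

/-- A preference profile: `true` means the agent prefers facility `F₁`,
`false` means the agent prefers facility `F₂`. -/
abbrev Pref (n : ℕ) := Fin n → Bool

/-- All agent locations lie in the unit interval `[0,1]`. -/
def validLoc {n : ℕ} (x : Loc n) : Prop := ∀ i, x i ∈ Set.Icc (0:ℝ) 1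

/-- The pair of facility locations lies in `[0,1]²`. -/
def inBox (y : ℝ × ℝ) : Prop := y.1 ∈ Set.Icc (0:ℝ) 1 ∧ y.2 ∈ Set.Icc (0:ℝ) 1

/-- The location of the facility indexed by `b` (`true` = `F₁`, `false` = `F₂`). -/
def facLoc (y : ℝ × ℝ) (b : Bool) : ℝ := if b then y.1 else y.2

/-- Cost of an agent located at `xi` whose preferred facility is `σi`:
`min(|xi − y_{σi}|, α·|xi − y_{3−σi}|)`. -/
def cost (α xi : ℝ) (σi : Bool) (y : ℝ × ℝ) : ℝ :=
  min |xi - facLoc y σi| (α * |xi - facLoc y (!σi)|)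

/-- Utility of an agent located at `xi` whose preferred facility is `σi`:
`max(1 − |xi − y_{σi}|, (1 − |xi − y_{3−σi}|)/α)`. -/
def util (α xi : ℝ) (σi : Bool) (y : ℝ × ℝ) : ℝ :=
  max (1 - |xi - facLoc y σi|) ((1 - |xi - facLoc y (!σi)|) / α)

/-- Total cost. -/
def SC {n : ℕ} (α : ℝ) (x : Loc n) (σ : Pref n) (y : ℝ × ℝ) : ℝ :=
  ∑ i, cost α (x i) (σ i) y

/-- Maximum cost. -/
def BC {n : ℕ} (α : ℝ) (x : Loc n) (σ : Pref n) (y : ℝ × ℝ) : ℝ :=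
  ⨆ i, cost α (x i) (σ i) y

/-- Total utility. -/
def SU {n : ℕ} (α : ℝ) (x : Loc n) (σ : Pref n) (y : ℝ × ℝ) : ℝ :=
  ∑ i, util α (x i) (σ i) y

/-- Minimum utility. -/
def BU {n : ℕ} (α : ℝ) (x : Loc n) (σ : Pref n) (y : ℝ × ℝ) : ℝ :=
  ⨅ i, util α (x i) (σ i) y

/-- Optimal (minimal) total cost over `y ∈ [0,1]²`. -/
def optSC {n : ℕ} (α : ℝ) (x : Loc n) (σ : Pref n) : ℝ :=
  sInf {c | ∃ y, inBox y ∧ c = SC α x σ y}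

/-- Optimal (minimal) maximum cost over `y ∈ [0,1]²`. -/
def optBC {n : ℕ} (α : ℝ) (x : Loc n) (σ : Pref n) : ℝ :=
  sInf {c | ∃ y, inBox y ∧ c = BC α x σ y}

/-- Optimal (maximal) total utility over `y ∈ [0,1]²`. -/
def optSU {n : ℕ} (α : ℝ) (x : Loc n) (σ : Pref n) : ℝ :=
  sSup {c | ∃ y, inBox y ∧ c = SU α x σ y}

/-- Optimal (maximal) minimum utility over `y ∈ [0,1]²`. -/
def optBU {n : ℕ} (α : ℝ) (x : Loc n) (σ : Pref n) : ℝ :=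
  sSup {c | ∃ y, inBox y ∧ c = BU α x σ y}

/-- Strategyproofness in the private-preferences setting (cost version):
no agent can strictly decrease his cost by misreporting his preference. -/
def SPprefCost {n : ℕ} (α : ℝ) (f : Loc n → Pref n → ℝ × ℝ) : Prop :=
  ∀ x : Loc n, validLoc x → ∀ σ : Pref n, ∀ i : Fin n, ∀ b : Bool,
    cost α (x i) (σ i) (f x σ) ≤ cost α (x i) (σ i) (f x (Function.update σ i b))

/-- Strategyproofness in the private-preferences setting (utility version):
no agent can strictly increase his utility by misreporting his preference. -/
def SPprefUtil {n : ℕ} (α : ℝ) (f : Loc n → Pref n → ℝ × ℝ) : Prop :=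
  ∀ x : Loc n, validLoc x → ∀ σ : Pref n, ∀ i : Fin n, ∀ b : Bool,
    util α (x i) (σ i) (f x (Function.update σ i b)) ≤ util α (x i) (σ i) (f x σ)

/-- Group strategyproofness in the private-preferences setting (cost version):
for every joint misreport of preferences, some deviating agent does not
strictly decrease his cost. -/
def GSPprefCost {n : ℕ} (α : ℝ) (f : Loc n → Pref n → ℝ × ℝ) : Prop :=
  ∀ x : Loc n, validLoc x → ∀ σ σ' : Pref n, σ' ≠ σ →
    ∃ i : Fin n, σ' i ≠ σ i ∧
      cost α (x i) (σ i) (f x σ) ≤ cost α (x i) (σ i) (f x σ')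

/-- Group strategyproofness in the private-preferences setting (utility version). -/
def GSPprefUtil {n : ℕ} (α : ℝ) (f : Loc n → Pref n → ℝ × ℝ) : Prop :=
  ∀ x : Loc n, validLoc x → ∀ σ σ' : Pref n, σ' ≠ σ →
    ∃ i : Fin n, σ' i ≠ σ i ∧
      util α (x i) (σ i) (f x σ') ≤ util α (x i) (σ i) (f x σ)

/-- Strategyproofness in the private-locations setting (cost version). -/
def SPlocCost {n : ℕ} (α : ℝ) (f : Loc n → Pref n → ℝ × ℝ) : Prop :=
  ∀ x : Loc n, validLoc x → ∀ σ : Pref n, ∀ i : Fin n, ∀ z ∈ Set.Icc (0:ℝ) 1,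
    cost α (x i) (σ i) (f x σ) ≤ cost α (x i) (σ i) (f (Function.update x i z) σ)

/-- Strategyproofness in the private-locations setting (utility version). -/
def SPlocUtil {n : ℕ} (α : ℝ) (f : Loc n → Pref n → ℝ × ℝ) : Prop :=
  ∀ x : Loc n, validLoc x → ∀ σ : Pref n, ∀ i : Fin n, ∀ z ∈ Set.Icc (0:ℝ) 1,
    util α (x i) (σ i) (f (Function.update x i z) σ) ≤ util α (x i) (σ i) (f x σ)

/-- Group strategyproofness in the private-locations setting (cost version). -/
def GSPlocCost {n : ℕ} (α : ℝ) (f : Loc n → Pref n → ℝ × ℝ) : Prop :=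
  ∀ x : Loc n, validLoc x → ∀ σ : Pref n, ∀ x' : Loc n, validLoc x' → x' ≠ x →
    ∃ i : Fin n, x' i ≠ x i ∧
      cost α (x i) (σ i) (f x σ) ≤ cost α (x i) (σ i) (f x' σ)

/-- Anonymity: the output is invariant under simultaneous permutations of the agents. -/
def Anonymous {n : ℕ} (f : Loc n → Pref n → ℝ × ℝ) : Prop :=
  ∀ (x : Loc n) (σ : Pref n) (π : Equiv.Perm (Fin n)), f (x ∘ π) (σ ∘ π) = f x σ

/-- Mechanism 1: `F₁` at `(lt+lb)/2` and `F₂` at `(rt+rb)/2`, where `lt`,`rt` are the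
extreme agent locations, `cen` their midpoint, `lb` (`rb`) the agent location closest
to `cen` from the left (right). -/
def mech1 {n : ℕ} (x : Loc n) : ℝ × ℝ :=
  ((⨅ i, x i) / 2 + sSup {z | (∃ i, x i = z) ∧ z ≤ ((⨅ i, x i) + (⨆ i, x i)) / 2} / 2,
   (⨆ i, x i) / 2 + sInf {z | (∃ i, x i = z) ∧ ((⨅ i, x i) + (⨆ i, x i)) / 2 ≤ z} / 2)

/-- Mechanism 2: `F₁` at the midpoint of the extreme locations of agents reporting
preference `F₁`, and likewise for `F₂`. -/
def mech2 {n : ℕ} (x : Loc n) (σ : Pref n) : ℝ × ℝ :=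
  ((sInf {z | ∃ i, σ i = true ∧ x i = z} + sSup {z | ∃ i, σ i = true ∧ x i = z}) / 2,
   (sInf {z | ∃ i, σ i = false ∧ x i = z} + sSup {z | ∃ i, σ i = false ∧ x i = z}) / 2)

/-- Mechanism 3: both facilities at `1/2`. -/
def mech3 : ℝ × ℝ := (1/2, 1/2)

/-- Mechanism 4: facilities at the two extreme reported locations. -/
def mech4 {n : ℕ} (x : Loc n) : ℝ × ℝ := (⨅ i, x i, ⨆ i, x i)

end

/-- Mechanism 2 puts each demanded facility midway between two extreme agents demanding it. -/
theorem exists_extremes_mech2 {n : ℕ} (x : Loc n) (σ : Pref n) (b : Bool) (h : ∃ i, σ i = b) :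
    ∃ p q, σ p = b ∧ σ q = b ∧ (∀ i, σ i = b → x p ≤ x i ∧ x i ≤ x q) ∧
      facLoc (mech2 x σ) b = (x p + x q) / 2 := by
  have hne : {z | ∃ i, σ i = b ∧ x i = z}.Nonempty := h.imp' x fun i hi => ⟨i, hi, rfl⟩
  have hfin : {z | ∃ i, σ i = b ∧ x i = z}.Finite :=
    (Set.finite_range x).subset fun z ⟨i, _, hi⟩ => ⟨i, hi⟩
  obtain ⟨p, hp, hpe⟩ := hne.csInf_mem hfin
  obtain ⟨q, hq, hqe⟩ := hne.csSup_mem hfin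
  refine ⟨p, q, hp, hq, fun i hi => ⟨?_, ?_⟩, ?_⟩
  · exact hpe ▸ csInf_le hfin.bddBelow ⟨i, hi, rfl⟩
  · exact hqe ▸ le_csSup hfin.bddAbove ⟨i, hi, rfl⟩
  · rw [hpe, hqe]
    cases b <;> simp [facLoc, mech2]

theorem abs_sub_midpoint_le {a b c : ℝ} (h : a ≤ c ∧ c ≤ b) :
    |c - (a + b) / 2| ≤ (b - a) / 2 :=
  abs_le.2 ⟨by linarith, by linarith⟩

theorem one_sub_abs_div_le_half {α : ℝ} (hα : 2 ≤ α) (z : ℝ) : (1 - |z|) / α ≤ 1 / 2 := by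
  rw [div_le_iff₀ (by linarith)]
  linarith [abs_nonneg z]

theorem util_le_one {α : ℝ} (hα : 2 ≤ α) (xi : ℝ) (b : Bool) (y : ℝ × ℝ) :
    util α xi b y ≤ 1 :=
  max_le (by linarith [abs_nonneg (xi - facLoc y b)])
    (by linarith [one_sub_abs_div_le_half hα (xi - facLoc y (!b))])

/-- An agent within distance `1/2` of his preferred facility cannot gain unless that facility
gets strictly closer. -/
theorem util_le_util_of_abs_le {α : ℝ} (hα : 2 ≤ α) {xi : ℝ} {b : Bool} {y y' : ℝ × ℝ}
    (hy : |xi - facLoc y b| ≤ 1 / 2) (hyy' : |xi - facLoc y b| ≤ |xi - facLoc y' b|) :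
    util α xi b y' ≤ util α xi b y :=
  le_max_of_le_left <| max_le (by linarith)
    (by linarith [one_sub_abs_div_le_half hα (xi - facLoc y' (!b))])

theorem util_mech2_update_le {α : ℝ} (hα : 2 ≤ α) {n : ℕ} {x : Loc n} (hx : validLoc x)
    (σ : Pref n) (i : Fin n) (b : Bool) :
    util α (x i) (σ i) (mech2 x (Function.update σ i b)) ≤
      util α (x i) (σ i) (mech2 x σ) := by
  by_cases hb : b = σ i
  · rw [hb, Function.update_eq_self]
  obtain ⟨p, q, hp, hq, hpq, hmid⟩ := exists_extremes_mech2 x σ (σ i) ⟨i, rfl⟩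
  have hi := abs_sub_midpoint_le (hpq i rfl)
  have hp0 := (hx p).1
  have hq1 := (hx q).2
  by_cases hj : ∃ j, Function.update σ i b j = σ i
  · obtain ⟨p', q', hp', hq', hpq', hmid'⟩ := exists_extremes_mech2 x _ (σ i) hj
    have hne : ∀ j, Function.update σ i b j = σ i → σ j = σ i := by
      intro j hj
      by_cases hji : j = i
      · rw [hji]
      · rwa [Function.update_of_ne hji] at hj
    have hp'' := (hpq p' (hne p' hp')).1
    have hq'' := (hpq q' (hne q' hq')).2
    have hpi : p ≠ i → x p' ≤ x p := fun h =>
      (hpq' p (by rwa [Function.update_of_ne h])).1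
    have hqi : q ≠ i → x q ≤ x q' := fun h =>
      (hpq' q (by rwa [Function.update_of_ne h])).2
    have hp'q' := (hpq' p' hp').2
    refine util_le_util_of_abs_le hα (by rw [hmid]; linarith) ?_
    rw [hmid, hmid']
    by_cases h1 : p = i
    · subst h1
      rw [abs_sub_comm, abs_sub_comm (x p), abs_of_nonneg (by linarith [(hpq p rfl).2]),
        abs_of_nonneg (by linarith)]
      by_cases h2 : q = p
      · subst h2
        linarith
      · linarith [hqi h2]
    · by_cases h2 : q = i
      · subst h2
        have := hpi h1
        rw [abs_of_nonneg (by linarith [(hpq q rfl).1]), abs_of_nonneg (by linarith)]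
        linarith
      · rw [le_antisymm (hpi h1) hp'', le_antisymm hq'' (hqi h2)]
  · have hall : ∀ j, σ j = σ i → j = i := fun j h => by
      by_contra hji
      exact hj ⟨j, by rwa [Function.update_of_ne hji]⟩
    rw [hall p hp, hall q hq] at hmid
    refine (util_le_one hα _ _ _).trans (le_max_of_le_left ?_)
    rw [hmid, add_self_div_two, sub_self, abs_zero, sub_zero]

theorem inBox_mech2 {n : ℕ} {x : Loc n} (hx : validLoc x) {σ : Pref n}
    (h : ∀ b, ∃ i, σ i = b) : inBox (mech2 x σ) := by
  have key : ∀ b, facLoc (mech2 x σ) b ∈ Set.Icc (0 : ℝ) 1 := fun b => by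
    obtain ⟨p, q, -, -, -, hmid⟩ := exists_extremes_mech2 x σ b (h b)
    rw [hmid]
    exact ⟨by linarith [(hx p).1, (hx q).1], by linarith [(hx p).2, (hx q).2]⟩
  exact ⟨key true, key false⟩

theorem BU_le_util {n : ℕ} (α : ℝ) (x : Loc n) (σ : Pref n) (y : ℝ × ℝ) (i : Fin n) :
    BU α x σ y ≤ util α (x i) (σ i) y :=
  ciInf_le (Set.finite_range _).bddBelow i

theorem BU_le_BU_mech2 {α : ℝ} (hα : 2 ≤ α) {n : ℕ} {x : Loc n} (hx : validLoc x)
    (σ : Pref n) (y : ℝ × ℝ) : BU α x σ y ≤ BU α x σ (mech2 x σ) := by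
  rcases isEmpty_or_nonempty (Fin n) with hn | hn
  · simp [BU]
  refine le_ciInf fun i => ?_
  obtain ⟨p, q, hp, hq, hpq, hmid⟩ := exists_extremes_mech2 x σ (σ i) ⟨i, rfl⟩
  have hi := abs_sub_midpoint_le (hpq i rfl)
  have hpu := BU_le_util α x σ y p
  have hqu := BU_le_util α x σ y q
  rw [hp] at hpu
  rw [hq] at hqu
  have hp0 := (hx p).1
  have hq1 := (hx q).2
  refine le_max_of_le_left ?_
  rw [hmid]
  rcases le_max_iff.1 hpu with h1 | h1
  · rcases le_max_iff.1 hqu with h2 | h2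
    · linarith [neg_abs_le (x p - facLoc y (σ i)), le_abs_self (x q - facLoc y (σ i))]
    · linarith [one_sub_abs_div_le_half hα (x q - facLoc y (!σ i))]
  · linarith [one_sub_abs_div_le_half hα (x p - facLoc y (!σ i))]

/-- For `α ≥ 2`, on instances where both facilities are preferred by some agent,
Mechanism 2 is strategyproof with private preferences and achieves the optimal
minimum utility. -/
theorem stmt_7 (α : ℝ) (hα : 2 ≤ α) (n : ℕ) :
    (∀ x : Loc n, validLoc x → ∀ σ : Pref n,
      (∃ i, σ i = true) → (∃ i, σ i = false) →
      ∀ (i : Fin n) (b : Bool),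
        util α (x i) (σ i) (mech2 x (Function.update σ i b)) ≤
          util α (x i) (σ i) (mech2 x σ)) ∧
    (∀ x : Loc n, validLoc x → ∀ σ : Pref n,
      (∃ i, σ i = true) → (∃ i, σ i = false) →
      BU α x σ (mech2 x σ) = optBU α x σ) := by
  refine ⟨fun x hx σ _ _ i b => util_mech2_update_le hα hx σ i b, fun x hx σ ht hf => ?_⟩
  have hbox : inBox (mech2 x σ) := inBox_mech2 hx (Bool.rec hf ht)
  have hmax : IsGreatest {c | ∃ y, inBox y ∧ c = BU α x σ y} (BU α x σ (mech2 x σ)) := by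
    refine ⟨⟨_, hbox, rfl⟩, ?_⟩
    rintro _ ⟨y, -, rfl⟩
    exact BU_le_BU_mech2 hα hx σ y
  exact hmax.csSup_eq.symm
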